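/- Let A be the companion matrix of f(x) = (x-1)^5 and B the companion matrix of g(x) = (x+1)(x⁴+x³+x²+x+1), and set T = B·A⁻¹ in GL(5,ℚ). Then T² = I with T ≠ I, B has order 10 and no power of B equals −I, and the hypergeometric group Γ(f,g) = ⟨A,B⟩ is the free product of the subgroup generated by T and the subgroup generated by B: the canonical group homomorphism from the abstract free product (ℤ/2ℤ) ∗ (ℤ/10ℤ) to GL(5,ℚ) sending the generator of ℤ/2ℤ to T and the generator of ℤ/10ℤ to B is injective with image Γ(f,g). -/

import Mathlib

open Polynomial Matrix

/-- The companion matrix of a monic degree-5 rational polynomial `p`: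
the `5 × 5` matrix whose entries in position `(i+1, i)` equal `1` for
`i = 1, ..., 4`, whose last column is `(-p₀, -p₁, -p₂, -p₃, -p₄)ᵀ`
(where `pᵢ` is the coefficient of `xⁱ` in `p`), and whose remaining
entries are `0`. -/
def companionMatrix (p : ℚ[X]) : Matrix (Fin 5) (Fin 5) ℚ :=
  Matrix.of fun i j : Fin 5 =>
    if (j : ℕ) = 4 then -p.coeff i
    else if (i : ℕ) = (j : ℕ) + 1 then 1 else 0

open scoped Pointwise in
/-- The ping-pong lemma for a binary free product. -/
theorem Monoid.Coprod.lift_injective_of_ping_pong {M : Bool → Type*} {K α : Type*}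
    [∀ b, Group (M b)] [Group K] [MulAction K α] (f : ∀ b, M b →* K) (X : Bool → Set α)
    (hcard : ∃ b, 3 ≤ Cardinal.mk (M b)) (hX : ∀ b, (X b).Nonempty)
    (hdisj : Disjoint (X true) (X false))
    (htrue : ∀ a, a ≠ 1 → f true a • X false ⊆ X true)
    (hfalse : ∀ a, a ≠ 1 → f false a • X true ⊆ X false) :
    Function.Injective (Monoid.Coprod.lift (f true) (f false)) := by
  let ψ : Monoid.Coprod (M true) (M false) →* Monoid.CoprodI M :=
    Monoid.Coprod.lift Monoid.CoprodI.of Monoid.CoprodI.of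
  let incl : ∀ b, M b →* Monoid.Coprod (M true) (M false) := fun b => match b with
    | true => Monoid.Coprod.inl
    | false => Monoid.Coprod.inr
  have hψ : (Monoid.CoprodI.lift incl).comp ψ = MonoidHom.id _ := by
    ext x <;> simp [ψ, incl]
  have hψ_inj : Function.Injective ψ :=
    Function.LeftInverse.injective (g := Monoid.CoprodI.lift incl) (DFunLike.congr_fun hψ)
  have hlift : Monoid.Coprod.lift (f true) (f false) = (Monoid.CoprodI.lift f).comp ψ := by
    ext x <;> simp [ψ]
  rw [hlift, MonoidHom.coe_comp]
  refine (Monoid.CoprodI.lift_injective_of_ping_pong f (Or.inr hcard) X hX ?_ ?_).comp hψ_inj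
  · rintro (_ | _) (_ | _) h
    exacts [absurd rfl h, hdisj.symm, hdisj, absurd rfl h]
  · rintro (_ | _) (_ | _) h
    exacts [absurd rfl h, hfalse, htrue, absurd rfl h]

/-- The homomorphism `ℤ/n → G` sending the generator to an element `g` with `g ^ n = 1`. -/
def zmodPowHom {G : Type*} [Group G] (n : ℕ) [NeZero n] (g : G) (hg : g ^ n = 1) :
    Multiplicative (ZMod n) →* G :=
  MonoidHom.mk' (fun a => g ^ (Multiplicative.toAdd a).val) fun a b => by
    rw [toAdd_mul, ZMod.val_add, ← pow_eq_pow_mod _ hg, pow_add]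

theorem range_zmodPowHom {G : Type*} [Group G] (n : ℕ) [NeZero n] (g : G) (hg : g ^ n = 1)
    (hgen : zmodPowHom n g hg (Multiplicative.ofAdd 1) = g) :
    (zmodPowHom n g hg).range = Subgroup.zpowers g := by
  apply le_antisymm
  · rintro _ ⟨a, rfl⟩
    exact Subgroup.npow_mem_zpowers g _
  · rw [Subgroup.zpowers_le]
    exact ⟨_, hgen⟩

namespace HypergeometricCaseFive

/-- Multiplication by the companion matrix of `(X + 1) * (X ^ 4 + X ^ 3 + X ^ 2 + X + 1)`. -/
def rotate (x : Fin 5 → ℚ) : Fin 5 → ℚ :=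
  ![-x 4, x 0 - 2 * x 4, x 1 - 2 * x 4, x 2 - 2 * x 4, x 3 - 2 * x 4]

/-- The reflection `T = B * A⁻¹`. -/
def reflect (x : Fin 5 → ℚ) : Fin 5 → ℚ :=
  ![-x 0, x 1 + 3 * x 0, x 2 - 12 * x 0, x 3 + 8 * x 0, x 4 - 7 * x 0]

/-- An open polyhedral cone that, up to sign, is mapped into itself by each `T * B ^ k`,
`1 ≤ k ≤ 9`, and, up to sign, is disjoint from its image under each such `B ^ k`. -/
def cone : Set (Fin 5 → ℚ) := {x |
  0 < 49 * x 0 + 9 * x 1 - x 2 - x 3 - x 4 ∧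
  0 < -4 * x 0 - 2 * x 1 + x 2 ∧
  0 < 34 * x 0 - 12 * x 1 - 3 * x 2 + x 3 ∧
  0 < 46 * x 0 - 14 * x 1 - 9 * x 2 - 4 * x 3 + x 4 ∧
  0 < 9 * x 0 - x 1 - x 2 - x 3 - x 4 ∧
  0 < 61 * x 0 + x 1 + x 2 + x 3 - 9 * x 4 ∧
  0 < -6 * x 0 - x 3 + 2 * x 4 ∧
  0 < 6 * x 0 - x 2 + 3 * x 3 + 12 * x 4 ∧
  0 < -6 * x 0 - x 1 + 4 * x 2 + 9 * x 3 + 14 * x 4 ∧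
  0 < x 0 + x 1 + x 2 + x 3 + x 4 ∧
  0 < -4 * x 0 + x 1 + 71 * x 2 - 104 * x 3 + 81 * x 4 ∧
  0 < 94 * x 0 - 81 * x 1 + 104 * x 2 - 71 * x 3 - x 4}

theorem iterate_five_rotate (x : Fin 5 → ℚ) :
    rotate^[5] x =
      let s := 2 * (x 0 - x 1 + x 2 - x 3 + x 4)
      ![x 0 - s, x 1 - s, x 2 - s, x 3 - s, x 4 - s] := by
  ext i
  fin_cases i <;>
    simp only [rotate, Function.iterate_succ, Function.iterate_zero, Function.comp_apply, id_eq,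
      Matrix.cons_val, Fin.reduceFinMk, Fin.zero_eta, Fin.mk_one] <;> ring

theorem cone_nonempty : cone.Nonempty := by
  refine ⟨![1, -4, -3, 1, 6], ?_⟩
  simp only [cone, Set.mem_ofPred_eq, Matrix.cons_val]
  norm_num

set_option maxHeartbeats 2000000 in
theorem reflect_iterate_rotate_mem {k : ℕ} (hk : 1 ≤ k) (hk' : k ≤ 9) {x : Fin 5 → ℚ}
    (hx : x ∈ cone) : (-1 : ℚ) ^ (k + 1) • reflect (rotate^[k] x) ∈ cone := by
  obtain ⟨h1, h2, h3, h4, h5, h6, h7, h8, h9, h10, h11, h12⟩ := hx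
  interval_cases k <;>
    simp only [cone, reflect, rotate, Function.iterate_succ, Function.iterate_zero,
      Function.comp_apply, id_eq, Set.mem_ofPred_eq, Pi.smul_apply, smul_eq_mul,
      Matrix.cons_val, pow_succ, pow_zero, one_mul, neg_mul, mul_neg, neg_neg, mul_one] <;>
    refine ⟨?_, ?_, ?_, ?_, ?_, ?_, ?_, ?_, ?_, ?_, ?_, ?_⟩ <;> linarith

set_option maxHeartbeats 2000000 in
theorem iterate_rotate_notMem {k : ℕ} (hk : 1 ≤ k) (hk' : k ≤ 9) {x : Fin 5 → ℚ}
    (hx : x ∈ cone) : rotate^[k] x ∉ cone ∧ -rotate^[k] x ∉ cone := by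
  obtain ⟨h1, h2, h3, h4, h5, h6, h7, h8, h9, h10, h11, h12⟩ := hx
  constructor <;> intro h <;>
    interval_cases k <;>
    simp only [cone, rotate, Function.iterate_succ, Function.iterate_zero,
      Function.comp_apply, id_eq, Set.mem_ofPred_eq, Pi.neg_apply, Matrix.cons_val] at h <;>
    obtain ⟨g1, g2, g3, g4, g5, g6, g7, g8, g9, g10, g11, g12⟩ := h <;> linarith

theorem companionMatrix_X_sub_one_pow :
    companionMatrix ((X - 1) ^ 5) =
      !![0, 0, 0, 0, 1; 1, 0, 0, 0, -5; 0, 1, 0, 0, 10; 0, 0, 1, 0, -10; 0, 0, 0, 1, 5] := by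
  have h : ((X - 1) ^ 5 : ℚ[X]) =
      X ^ 5 + C (-5) * X ^ 4 + C 10 * X ^ 3 + C (-10) * X ^ 2 + C 5 * X + C (-1) := by
    simp only [map_neg, map_ofNat, map_one]
    ring
  ext i j
  rw [h, companionMatrix]
  fin_cases i <;> fin_cases j <;> simp [coeff_X, coeff_one, coeff_X_pow]

theorem companionMatrix_X_add_one_mul :
    companionMatrix ((X + 1) * (X ^ 4 + X ^ 3 + X ^ 2 + X + 1)) =
      !![0, 0, 0, 0, -1; 1, 0, 0, 0, -2; 0, 1, 0, 0, -2; 0, 0, 1, 0, -2; 0, 0, 0, 1, -2] := by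
  have h : ((X + 1) * (X ^ 4 + X ^ 3 + X ^ 2 + X + 1) : ℚ[X]) =
      X ^ 5 + C 2 * X ^ 4 + C 2 * X ^ 3 + C 2 * X ^ 2 + C 2 * X + C 1 := by
    simp only [map_ofNat, map_one]
    ring
  ext i j
  rw [h, companionMatrix]
  fin_cases i <;> fin_cases j <;> simp [coeff_X, coeff_one, coeff_X_pow]

section

variable {A B T : GL (Fin 5) ℚ}

open scoped Matrix.Module

theorem companion_smul
    (hB : (↑B : Matrix (Fin 5) (Fin 5) ℚ) =
      companionMatrix ((X + 1) * (X ^ 4 + X ^ 3 + X ^ 2 + X + 1))) (x : Fin 5 → ℚ) :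
    B • x = rotate x := by
  ext i
  rw [Units.smul_def, Matrix.Module.smul_apply, hB, companionMatrix_X_add_one_mul]
  fin_cases i <;> simp [rotate, Fin.sum_univ_five] <;> ring

theorem companion_pow_smul
    (hB : (↑B : Matrix (Fin 5) (Fin 5) ℚ) =
      companionMatrix ((X + 1) * (X ^ 4 + X ^ 3 + X ^ 2 + X + 1))) (k : ℕ) (x : Fin 5 → ℚ) :
    B ^ k • x = rotate^[k] x := by
  rw [← funext (companion_smul hB), smul_iterate]

theorem reflection_smul
    (hA : (↑A : Matrix (Fin 5) (Fin 5) ℚ) = companionMatrix ((X - 1) ^ 5))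
    (hB : (↑B : Matrix (Fin 5) (Fin 5) ℚ) =
      companionMatrix ((X + 1) * (X ^ 4 + X ^ 3 + X ^ 2 + X + 1)))
    (hT : T = B * A⁻¹) (x : Fin 5 → ℚ) : T • x = reflect x := by
  obtain ⟨y, rfl⟩ := MulAction.surjective A x
  beta_reduce
  rw [hT, mul_smul, inv_smul_smul, companion_smul hB, Units.smul_def, hA,
    companionMatrix_X_sub_one_pow]
  ext i
  fin_cases i <;> simp [rotate, reflect, Matrix.Module.smul_apply, Fin.sum_univ_five] <;> ring

theorem eq_one_of_forall_smul_eq (h : ∀ x : Fin 5 → ℚ, A • x = x) : A = 1 := by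
  ext i j
  simpa [Units.smul_def, Matrix.one_apply, Pi.single_apply] using congrFun (h (Pi.single j 1)) i

theorem reflection_sq
    (hA : (↑A : Matrix (Fin 5) (Fin 5) ℚ) = companionMatrix ((X - 1) ^ 5))
    (hB : (↑B : Matrix (Fin 5) (Fin 5) ℚ) =
      companionMatrix ((X + 1) * (X ^ 4 + X ^ 3 + X ^ 2 + X + 1)))
    (hT : T = B * A⁻¹) : T ^ 2 = 1 := by
  refine eq_one_of_forall_smul_eq fun x => ?_
  rw [pow_two, mul_smul, reflection_smul hA hB hT, reflection_smul hA hB hT]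
  ext i
  fin_cases i <;> simp [reflect]

theorem reflection_ne_one
    (hA : (↑A : Matrix (Fin 5) (Fin 5) ℚ) = companionMatrix ((X - 1) ^ 5))
    (hB : (↑B : Matrix (Fin 5) (Fin 5) ℚ) =
      companionMatrix ((X + 1) * (X ^ 4 + X ^ 3 + X ^ 2 + X + 1)))
    (hT : T = B * A⁻¹) : T ≠ 1 := by
  intro h
  have h0 := congrFun (reflection_smul hA hB hT 1) 0
  rw [h, one_smul] at h0
  norm_num [reflect] at h0

theorem orderOf_companion
    (hB : (↑B : Matrix (Fin 5) (Fin 5) ℚ) =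
      companionMatrix ((X + 1) * (X ^ 4 + X ^ 3 + X ^ 2 + X + 1))) :
    orderOf B = 10 := by
  rw [orderOf_eq_iff (by norm_num)]
  refine ⟨eq_one_of_forall_smul_eq fun x => ?_, fun k hk hk' h => ?_⟩
  · rw [companion_pow_smul hB, Function.iterate_add_apply rotate 5 5, iterate_five_rotate,
      iterate_five_rotate]
    ext i
    fin_cases i <;> simp only [Matrix.cons_val, Fin.reduceFinMk, Fin.zero_eta, Fin.mk_one] <;> ring
  · obtain ⟨x, hx⟩ := cone_nonempty
    apply (iterate_rotate_notMem hk' (Nat.le_of_lt_succ hk) hx).1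
    rwa [← companion_pow_smul hB, h, one_smul]

theorem companion_zpow_ne_neg_one
    (hB : (↑B : Matrix (Fin 5) (Fin 5) ℚ) =
      companionMatrix ((X + 1) * (X ^ 4 + X ^ 3 + X ^ 2 + X + 1))) (i : ℤ) :
    B ^ i ≠ -1 := by
  intro h
  have horder := orderOf_companion hB
  obtain ⟨k, hk⟩ : B ^ i ∈ Submonoid.powers B :=
    (orderOf_pos_iff.mp (by omega)).mem_powers_iff_mem_zpowers.mpr ⟨i, rfl⟩
  have hmod : B ^ (k % 10) = -1 := by
    rw [← horder, pow_mod_orderOf]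
    exact hk.trans h
  obtain ⟨x, hx⟩ := cone_nonempty
  have hneg : rotate^[k % 10] x = -x := by
    rw [← companion_pow_smul hB, hmod, Units.neg_smul, one_smul]
  obtain h0 | hpos := Nat.eq_zero_or_pos (k % 10)
  · rw [h0, Function.iterate_zero, id_eq, self_eq_neg] at hneg
    subst hneg
    exact absurd hx.1 (by simp)
  · apply (iterate_rotate_notMem hpos (by omega) hx).2
    rwa [hneg, neg_neg]

/-- The ping-pong sets: `true` gives the double cone `±cone`, and `false` the union of its images
under the nontrivial powers of `B`. -/
def table (B : GL (Fin 5) ℚ) : Bool → Set (Fin 5 → ℚ)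
  | true => {x | x ∈ cone ∨ -x ∈ cone}
  | false => {x | ∃ k, 1 ≤ k ∧ k ≤ 9 ∧ ∃ y, (y ∈ cone ∨ -y ∈ cone) ∧ B ^ k • y = x}

theorem neg_mem_table_true {x : Fin 5 → ℚ} :
    -x ∈ table B true ↔ x ∈ table B true := by
  change (-x ∈ cone ∨ - -x ∈ cone) ↔ (x ∈ cone ∨ -x ∈ cone)
  rw [neg_neg, or_comm]

theorem table_nonempty (b : Bool) : (table B b).Nonempty := by
  obtain ⟨x, hx⟩ := cone_nonempty
  cases b
  · exact ⟨_, 1, le_rfl, by norm_num, x, Or.inl hx, rfl⟩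
  · exact ⟨x, Or.inl hx⟩

theorem table_disjoint
    (hB : (↑B : Matrix (Fin 5) (Fin 5) ℚ) =
      companionMatrix ((X + 1) * (X ^ 4 + X ^ 3 + X ^ 2 + X + 1))) :
    Disjoint (table B true) (table B false) := by
  have key {k : ℕ} (hk : 1 ≤ k) (hk' : k ≤ 9) {y : Fin 5 → ℚ} (hy : y ∈ cone) :
      B ^ k • y ∉ table B true := by
    rw [companion_pow_smul hB]
    exact not_or_intro (iterate_rotate_notMem hk hk' hy).1 (iterate_rotate_notMem hk hk' hy).2
  rw [Set.disjoint_right]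
  rintro _ ⟨k, hk, hk', y, hy | hy, rfl⟩
  · exact key hk hk' hy
  · rw [← neg_mem_table_true, ← smul_neg]
    exact key hk hk' hy

theorem reflection_smul_mem_table
    (hA : (↑A : Matrix (Fin 5) (Fin 5) ℚ) = companionMatrix ((X - 1) ^ 5))
    (hB : (↑B : Matrix (Fin 5) (Fin 5) ℚ) =
      companionMatrix ((X + 1) * (X ^ 4 + X ^ 3 + X ^ 2 + X + 1)))
    (hT : T = B * A⁻¹) {x : Fin 5 → ℚ} (hx : x ∈ table B false) : T • x ∈ table B true := by
  have key {k : ℕ} (hk : 1 ≤ k) (hk' : k ≤ 9) {y : Fin 5 → ℚ} (hy : y ∈ cone) :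
      T • B ^ k • y ∈ table B true := by
    have h := reflect_iterate_rotate_mem hk hk' hy
    rw [companion_pow_smul hB, reflection_smul hA hB hT]
    obtain hs | hs := neg_one_pow_eq_or ℚ (k + 1)
    · exact Or.inl (by simpa [hs] using h)
    · exact Or.inr (by simpa [hs] using h)
  obtain ⟨k, hk, hk', y, hy | hy, rfl⟩ := hx
  · exact key hk hk' hy
  · rw [← neg_mem_table_true, ← smul_neg, ← smul_neg]
    exact key hk hk' hy

theorem pow_smul_mem_table {k : ℕ} (hk : 1 ≤ k) (hk' : k ≤ 9) {x : Fin 5 → ℚ}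
    (hx : x ∈ table B true) : B ^ k • x ∈ table B false :=
  ⟨k, hk, hk', x, hx, rfl⟩

end

end HypergeometricCaseFive

open HypergeometricCaseFive

open scoped Matrix.Module in
/-- `Γ(f,g) = ⟨T⟩ ∗ ⟨B⟩` for `f = ((X - 1) ^ 5)`, `g = ((X + 1) * (X ^ 4 + X ^ 3 + X ^ 2 + X + 1))`. -/
theorem hypergeometric_free_product_case5 (A B T : GL (Fin 5) ℚ)
    (hA : (↑A : Matrix (Fin 5) (Fin 5) ℚ) = companionMatrix ((X - 1) ^ 5))
    (hB : (↑B : Matrix (Fin 5) (Fin 5) ℚ) = companionMatrix ((X + 1) * (X ^ 4 + X ^ 3 + X ^ 2 + X + 1)))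
    (hT : T = B * A⁻¹) :
    T ^ 2 = 1 ∧ T ≠ 1 ∧ orderOf B = 10 ∧ (∀ i : ℤ, B ^ i ≠ -1) ∧
    ∃ φ : Monoid.Coprod (Multiplicative (ZMod 2)) (Multiplicative (ZMod 10)) →* GL (Fin 5) ℚ,
      φ (Monoid.Coprod.inl (Multiplicative.ofAdd (1 : ZMod 2))) = T ∧
      φ (Monoid.Coprod.inr (Multiplicative.ofAdd (1 : ZMod 10))) = B ∧
      Function.Injective φ ∧
      φ.range = Subgroup.closure {A, B} := by
  have hT_sq := reflection_sq hA hB hT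
  have hB_order := orderOf_companion hB
  have hB_pow : B ^ 10 = 1 := hB_order ▸ pow_orderOf_eq_one B
  refine ⟨hT_sq, reflection_ne_one hA hB hT, hB_order, companion_zpow_ne_neg_one hB,
    Monoid.Coprod.lift (zmodPowHom 2 T hT_sq) (zmodPowHom 10 B hB_pow), ?_, ?_, ?_, ?_⟩
  · rw [Monoid.Coprod.lift_apply_inl]
    exact pow_one T
  · rw [Monoid.Coprod.lift_apply_inr]
    exact pow_one B
  · let f : ∀ b : Bool, Multiplicative (ZMod (bif b then 2 else 10)) →* GL (Fin 5) ℚ :=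
      fun b => match b with
        | true => zmodPowHom 2 T hT_sq
        | false => zmodPowHom 10 B hB_pow
    refine Monoid.Coprod.lift_injective_of_ping_pong f (table B) ⟨false, ?_⟩ table_nonempty
      (table_disjoint hB) ?_ ?_
    · change 3 ≤ Cardinal.mk (ZMod 10)
      rw [Cardinal.mk_fintype, ZMod.card]
      norm_num
    · rintro (a : ZMod 2) ha _ ⟨x, hx, rfl⟩
      have hval : a.val = 1 := by
        replace ha : a ≠ 0 := ha
        clear hx
        revert a
        decide
      change T ^ a.val • x ∈ table B true
      rw [hval, pow_one]
      exact reflection_smul_mem_table hA hB hT hx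
    · rintro (a : ZMod 10) ha _ ⟨x, hx, rfl⟩
      have hpos : a.val ≠ 0 := (ZMod.val_ne_zero a).mpr ha
      have hlt : a.val < 10 := ZMod.val_lt a
      exact pow_smul_mem_table (B := B) (k := a.val) (by omega) (by omega) hx
  · rw [Monoid.Coprod.range_lift, range_zmodPowHom 2 T hT_sq (pow_one T),
      range_zmodPowHom 10 B hB_pow (pow_one B)]
    have hBmem : B ∈ Subgroup.closure {A, B} := Subgroup.subset_closure (by simp)
    have hAmem : A ∈ Subgroup.closure {A, B} := Subgroup.subset_closure (by simp)
    apply le_antisymm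
    · rw [sup_le_iff, Subgroup.zpowers_le, Subgroup.zpowers_le, hT]
      exact ⟨mul_mem hBmem (inv_mem hAmem), hBmem⟩
    · rw [Subgroup.closure_le]
      have hTmem : T ∈ Subgroup.zpowers T ⊔ Subgroup.zpowers B :=
        (le_sup_left : Subgroup.zpowers T ≤ _) (Subgroup.mem_zpowers T)
      have hBmem' : B ∈ Subgroup.zpowers T ⊔ Subgroup.zpowers B :=
        (le_sup_right : Subgroup.zpowers B ≤ _) (Subgroup.mem_zpowers B)
      have hA_eq : A = T⁻¹ * B := by rw [hT]; group
      rintro g (rfl | rfl)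
      · rw [hA_eq]
        exact mul_mem (inv_mem hTmem) hBmem'
      · exact hBmem'
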